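/- arXiv:2109.10511 — 2 statements merged into one kernel-verified Lean document; each statement's English description precedes it below -/
import Mathlib

section
/- For every t ∈ ℂ, the operator exponential exp(itX) on ℓ²(ℕ) equals the sum of the operator-norm absolutely convergent double series Σ_{m,n ≥ 0} i^{m+n} (J_{m+n+2}(2t) + J_{m+n}(2t)) · S^m T^n. -/
open scoped InnerProductSpace

/-- Bessel function of the first kind of integer order `n`:
`J_n(z) = Σ_{p≥0} (-1)^p/(p!(n+p)!) (z/2)^{n+2p}`. -/
noncomputable def besselJ (n : ℕ) (z : ℂ) : ℂ :=
  ∑' p : ℕ, ((-1) ^ p / ((Nat.factorial p : ℂ) * (Nat.factorial (n + p) : ℂ))) *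
    (z / 2) ^ (n + 2 * p)


/-- Ballot numbers. -/
def bal : ℕ → ℕ → ℕ
  | 0, 0 => 1
  | 0, _ + 1 => 0
  | k + 1, 0 => bal k 1
  | k + 1, N + 1 => bal k N + bal k (N + 2)

theorem bal_zero_of_lt : ∀ (k N : ℕ), k < N → bal k N = 0
  | 0, 0, h => by omega
  | 0, _ + 1, _ => by simp [bal]
  | k + 1, 0, h => by omega
  | k + 1, N + 1, h => by
    simp [bal, bal_zero_of_lt k N (by omega), bal_zero_of_lt k (N + 2) (by omega)]

theorem bal_odd : ∀ (k N : ℕ), (k + N) % 2 = 1 → bal k N = 0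
  | 0, 0, h => by omega
  | 0, _ + 1, _ => by simp [bal]
  | k + 1, 0, h => by simp [bal, bal_odd k 1 (by omega)]
  | k + 1, N + 1, h => by
    simp [bal, bal_odd k N (by omega), bal_odd k (N + 2) (by omega)]

theorem bal_closed (k : ℕ) : ∀ N p : ℕ, k = N + 2 * p →
    bal k N * (p.factorial * (N + p + 1).factorial) = k.factorial * (N + 1) := by
  induction k with
  | zero =>
    intro N p h
    obtain rfl : N = 0 := by omega
    obtain rfl : p = 0 := by omega
    simp [bal]
  | succ k ih =>
    intro N p h
    match N, p with
    | 0, 0 => omega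
    | 0, p + 1 =>
      have h1 := ih 1 p (by omega)
      obtain rfl : k = 1 + 2 * p := by omega
      simp only [bal]
      rw [show 1 + p + 1 = p + 2 by ring] at h1
      rw [show 0 + (p + 1) + 1 = p + 2 by ring, Nat.factorial_succ p,
        Nat.factorial_succ (1 + 2 * p)]
      linear_combination (p + 1) * h1
    | N + 1, 0 =>
      have h1 := ih N 0 (by omega)
      obtain rfl : k = N := by omega
      simp only [bal, bal_zero_of_lt k (k + 2) (by omega)]
      simp only [Nat.factorial_zero, add_zero, one_mul] at h1 ⊢
      rw [Nat.factorial_succ (k + 1)]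
      have h2 := Nat.factorial_succ k
      rw [mul_left_comm, h1, h2]
      ring
    | N + 1, p + 1 =>
      have h1 := ih N (p + 1) (by omega)
      have h2 := ih (N + 2) p (by omega)
      obtain rfl : k = N + 2 * p + 2 := by omega
      rw [show bal (N + 2 * p + 2 + 1) (N + 1)
        = bal (N + 2 * p + 2) N + bal (N + 2 * p + 2) (N + 2) from rfl]
      rw [show N + (p + 1) + 1 = N + p + 2 by ring] at h1
      rw [show N + 2 + p + 1 = N + p + 3 by ring] at h2
      rw [show N + 1 + (p + 1) + 1 = N + p + 3 by ring, Nat.factorial_succ (N + 2 * p + 2)]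
      have h3 : (N + p + 3).factorial = (N + p + 3) * (N + p + 2).factorial :=
        Nat.factorial_succ _
      have h4 : (p + 1).factorial = (p + 1) * p.factorial := Nat.factorial_succ _
      rw [add_mul]
      have e1 : bal (N + 2 * p + 2) N * ((p + 1).factorial * (N + p + 3).factorial)
          = (N + p + 3) * ((N + 2 * p + 2).factorial * (N + 1)) := by
        rw [← h1, h3]; ring
      have e2 : bal (N + 2 * p + 2) (N + 2) * ((p + 1).factorial * (N + p + 3).factorial)
          = (p + 1) * ((N + 2 * p + 2).factorial * (N + 2 + 1)) := by
        rw [← h2, h4]; ring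
      rw [e1, e2]; ring

theorem bal_pow {R : Type*} [Ring R] (x : R) (w : ℕ → R) (h0 : w 0 = 1) (h1 : x * w 0 = w 1)
    (h2 : ∀ N, x * w (N + 1) = w (N + 2) + w N) (k : ℕ) :
    ∑ N ∈ Finset.range (k + 1), (bal k N : R) * w N = x ^ k := by
  induction k with
  | zero => simp [bal, h0]
  | succ k ih =>
    have hx : ∀ N, x * ((bal k N : R) * w N) = (bal k N : R) * (x * w N) := fun N => by
      rw [← mul_assoc, ← (Nat.cast_commute (bal k N) x).eq, mul_assoc]
    have hL : ∑ N ∈ Finset.range (k + 1 + 1), (bal (k + 1) N : R) * w N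
        = ∑ N ∈ Finset.range (k + 1), (bal k N : R) * w (N + 1)
          + (∑ N ∈ Finset.range (k + 1), (bal k (N + 1 + 1) : R) * w (N + 1)
            + (bal k (0 + 1) : R) * w 0) := by
      rw [Finset.sum_range_succ']
      simp only [bal, Nat.cast_add, add_mul, Finset.sum_add_distrib]
      rw [add_assoc]
    have h3 := Finset.sum_range_succ' (fun N => (bal k (N + 1) : R) * w N) (k + 1)
    rw [Finset.sum_range_succ, Finset.sum_range_succ, bal_zero_of_lt k (k + 1) (by omega),
      bal_zero_of_lt k (k + 1 + 1) (by omega)] at h3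
    simp only [Nat.cast_zero, zero_mul, add_zero] at h3
    rw [hL, ← h3, pow_succ', ← ih, Finset.mul_sum, Finset.sum_range_succ',
      Finset.sum_range_succ' _ k]
    simp only [hx, h1, h2, mul_add, Finset.sum_add_distrib]
    simp only [zero_add, add_assoc, Nat.reduceAdd]
    abel

theorem hasSum_antidiag {E : Type*} [AddCommMonoid E] [TopologicalSpace E]
    (k : ℕ) (f : ℕ × ℕ → E) (hf : ∀ mn : ℕ × ℕ, k < mn.1 + mn.2 → f mn = 0) :
    HasSum f (∑ N ∈ Finset.range (k + 1), ∑ mn ∈ Finset.HasAntidiagonal.antidiagonal N, f mn) := by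
  rw [← Finset.sum_biUnion]
  · apply hasSum_sum_of_ne_finset_zero
    intro mn h
    apply hf
    simp only [Finset.mem_biUnion, Finset.mem_range, Finset.HasAntidiagonal.mem_antidiagonal, not_exists,
      not_and] at h
    by_contra hh
    exact h (mn.1 + mn.2) (by omega) rfl
  · intro a _ b _ hab
    rw [Function.onFun, Finset.disjoint_left]
    intro mn h h'
    rw [Finset.HasAntidiagonal.mem_antidiagonal] at h h'
    omega

theorem bessel_summable (n : ℕ) (t : ℂ) : Summable (fun p : ℕ =>
    ((-1) ^ p / ((Nat.factorial p : ℂ) * (Nat.factorial (n + p) : ℂ))) *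
      ((2 * t) / 2) ^ (n + 2 * p)) := by
  have hs := (Real.summable_pow_div_factorial (‖t‖ ^ 2)).mul_left (‖t‖ ^ n)
  refine Summable.of_norm_bounded hs fun p => ?_
  rw [mul_div_cancel_left₀ t (by norm_num : (2 : ℂ) ≠ 0)]
  simp only [norm_mul, norm_div, norm_pow, norm_neg, norm_one, one_pow, Complex.norm_natCast]
  rw [pow_add, pow_mul]
  have h1 : (1 : ℝ) ≤ ((n + p).factorial : ℝ) := by exact_mod_cast Nat.factorial_pos _
  have h2 : (0 : ℝ) < (p.factorial : ℝ) := by exact_mod_cast Nat.factorial_pos _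
  have h3 : 1 / ((p.factorial : ℝ) * ((n + p).factorial : ℝ)) ≤ 1 / (p.factorial : ℝ) :=
    one_div_le_one_div_of_le h2 (by nlinarith)
  calc _ ≤ 1 / (p.factorial : ℝ) * (‖t‖ ^ n * (‖t‖ ^ 2) ^ p) := by gcongr
    _ = _ := by ring

theorem bessel_coeff (N : ℕ) (t : ℂ) :
    HasSum (fun k : ℕ => (Complex.I * t) ^ k / (k.factorial : ℂ) * (bal k N : ℂ))
      (Complex.I ^ N * (besselJ (N + 2) (2 * t) + besselJ N (2 * t))) := by
  have hinj : Function.Injective (fun p : ℕ => N + 2 * p) := fun a b h => by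
    simp only at h; omega
  rw [← hinj.hasSum_iff]
  · have hA := (bessel_summable (N + 2) t).hasSum
    have hB := (bessel_summable N t).hasSum
    set g : ℕ → ℂ := fun p => match p with
      | 0 => 0
      | p + 1 => ((-1) ^ p / ((Nat.factorial p : ℂ) * (Nat.factorial (N + 2 + p) : ℂ))) *
      ((2 * t) / 2) ^ (N + 2 + 2 * p) with hg
    have hA' : HasSum g (besselJ (N + 2) (2 * t)) := by
      rw [← hasSum_nat_add_iff' 1]
      simpa [hg, besselJ] using hA
    have := (hA'.add hB).mul_left (Complex.I ^ N)
    refine Eq.mp (congrArg (fun f : ℕ → ℂ => HasSum f _) (funext fun p => Eq.symm ?_)) this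
    simp only [Function.comp]
    have h2 : (2 * t) / 2 = t := mul_div_cancel_left₀ t (by norm_num : (2 : ℂ) ≠ 0)
    have hc : (bal (N + 2 * p) N : ℂ) * ((p.factorial : ℂ) * ((N + p + 1).factorial : ℂ))
        = ((N + 2 * p).factorial : ℂ) * (N + 1) := by
      exact_mod_cast bal_closed (N + 2 * p) N p rfl
    have f1 : ((N + 2 * p).factorial : ℂ) ≠ 0 := by exact_mod_cast Nat.factorial_ne_zero _
    have f2 : ((N + p + 1).factorial : ℂ) ≠ 0 := by exact_mod_cast Nat.factorial_ne_zero _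
    have f3 : (p.factorial : ℂ) ≠ 0 := by exact_mod_cast Nat.factorial_ne_zero _
    have f4 : ((N + p).factorial : ℂ) ≠ 0 := by exact_mod_cast Nat.factorial_ne_zero _
    have hb : (bal (N + 2 * p) N : ℂ) = ((N + 2 * p).factorial : ℂ) * (N + 1)
        / ((p.factorial : ℂ) * ((N + p + 1).factorial : ℂ)) := by
      rw [← hc]; field_simp
    have hI : Complex.I ^ (2 * p) = (-1) ^ p := by rw [pow_mul, Complex.I_sq]
    have hf : ((N + p + 1).factorial : ℂ) = (N + p + 1) * ((N + p).factorial : ℂ) := by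
      rw [Nat.factorial_succ]; push_cast; ring
    have f5 : (N + p + 1 : ℂ) ≠ 0 := by exact_mod_cast Nat.succ_ne_zero (N + p)
    rw [hb, h2, mul_pow, pow_add Complex.I, hI]
    match p with
    | 0 =>
      simp only [hg, hf]
      simp only [mul_zero, add_zero, Nat.factorial_zero] at *
      field_simp
      simp [mul_comm]
    | p + 1 =>
      have hq : ((p + 1).factorial : ℂ) = (p + 1) * (p.factorial : ℂ) := by
        rw [Nat.factorial_succ]; push_cast; ring
      have f6 : (p.factorial : ℂ) ≠ 0 := by exact_mod_cast Nat.factorial_ne_zero _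
      have f7 : (p + 1 : ℂ) ≠ 0 := by exact_mod_cast Nat.succ_ne_zero p
      simp only [hg]
      rw [show N + 2 + p = N + (p + 1) + 1 by ring, show N + 2 + 2 * p = N + 2 * (p + 1) by ring,
        h2, hf, hq, pow_succ (-1 : ℂ) p]
      push_cast at f5 ⊢
      field_simp
      ring
  · intro k hk
    rw [show bal k N = 0 from ?_]
    · simp
    by_cases h : k < N
    · exact bal_zero_of_lt _ _ h
    · apply bal_odd
      by_contra h'
      exact hk ⟨(k - N) / 2, by simp only; omega⟩

/-- Homogeneous normally ordered sums. -/
def normW {R : Type*} [Ring R] (S T : R) (N : ℕ) : R :=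
  ∑ mn ∈ Finset.HasAntidiagonal.antidiagonal N, S ^ mn.1 * T ^ mn.2

theorem normW_succ {R : Type*} [Ring R] (S T : R) (N : ℕ) :
    normW S T (N + 1) = T ^ (N + 1) + S * normW S T N := by
  simp [normW, Finset.Nat.antidiagonal_succ, Finset.mul_sum, pow_succ', mul_assoc]

theorem normW_zero {R : Type*} [Ring R] (S T : R) : normW S T 0 = 1 := by
  simp [normW]

theorem pow_normal {R : Type*} [Ring R] (S T : R) (h : T * S = 1) (k : ℕ) :
    ∑ N ∈ Finset.range (k + 1), (bal k N : R) * normW S T N = (S + T) ^ k := by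
  apply bal_pow
  · exact normW_zero S T
  · rw [normW_succ, normW_zero]; simp [add_comm]
  · intro N
    have h1 : T * normW S T (N + 1) = T ^ (N + 2) + normW S T N := by
      rw [normW_succ, mul_add, ← mul_assoc, h, one_mul, ← pow_succ']
    rw [add_mul, h1, normW_succ S T (N + 1)]
    abel

theorem pow_two_sum (k : ℕ) :
    ∑ N ∈ Finset.range (k + 1), (bal k N : ℝ) * ((N : ℝ) + 1) = 2 ^ k := by
  apply bal_pow (2 : ℝ) (fun N => (N : ℝ) + 1)
  · simp
  · norm_num
  · intro N; push_cast; ring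

set_option maxHeartbeats 1000000 in
theorem exp_normal {A : Type*} [NormedRing A] [NormedAlgebra ℂ A] [CompleteSpace A]
    (S T : A) (h : T * S = 1) (hn : ∀ m n : ℕ, ‖S ^ m * T ^ n‖ ≤ 1) (t : ℂ) :
    HasSum (fun mn : ℕ × ℕ =>
        (Complex.I ^ (mn.1 + mn.2) *
          (besselJ (mn.1 + mn.2 + 2) (2 * t) + besselJ (mn.1 + mn.2) (2 * t))) •
            (S ^ mn.1 * T ^ mn.2))
        (NormedSpace.exp ((Complex.I * t) • (S + T))) ∧
      Summable (fun mn : ℕ × ℕ =>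
        ‖(Complex.I ^ (mn.1 + mn.2) *
          (besselJ (mn.1 + mn.2 + 2) (2 * t) + besselJ (mn.1 + mn.2) (2 * t))) •
            (S ^ mn.1 * T ^ mn.2)‖) := by
  set z : ℂ := Complex.I * t with hz
  set F : ℕ × (ℕ × ℕ) → A := fun q =>
    (z ^ q.1 / (q.1.factorial : ℂ) * (bal q.1 (q.2.1 + q.2.2) : ℂ)) • (S ^ q.2.1 * T ^ q.2.2)
    with hF
  set B : ℕ × (ℕ × ℕ) → ℝ := fun q =>
    ‖z‖ ^ q.1 / (q.1.factorial : ℝ) * (bal q.1 (q.2.1 + q.2.2) : ℝ) with hB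
  have hB0 : ∀ q, 0 ≤ B q := fun q => by simp only [hB]; positivity
  have hFB : ∀ q, ‖F q‖ ≤ B q := fun q => by
    simp only [hF, hB, norm_smul, norm_mul, norm_div, norm_pow, Complex.norm_natCast]
    exact mul_le_of_le_one_right (by positivity) (hn _ _)
  have hBk : ∀ k, HasSum (fun mn => B (k, mn)) ((2 * ‖z‖) ^ k / (k.factorial : ℝ)) := by
    intro k
    have := hasSum_antidiag k (fun mn => B (k, mn)) (fun mn hmn => by
      simp [hB, bal_zero_of_lt _ _ hmn])
    convert this using 1
    rw [mul_pow, ← pow_two_sum, Finset.sum_mul, Finset.sum_div]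
    refine Finset.sum_congr rfl fun N _ => ?_
    rw [Finset.sum_congr rfl (g := fun _ => ‖z‖ ^ k / (k.factorial : ℝ) * (bal k N : ℝ))]
    · simp only [Finset.sum_const, Finset.Nat.card_antidiagonal, nsmul_eq_mul]
      push_cast; ring
    · intro mn hmn
      rw [Finset.HasAntidiagonal.mem_antidiagonal] at hmn
      simp [hB, hmn]
  have hBs : Summable B := by
    rw [summable_prod_of_nonneg hB0]
    refine ⟨fun k => (hBk k).summable, ?_⟩
    simp only [fun k => (hBk k).tsum_eq]
    exact Real.summable_pow_div_factorial _
  have hFs : Summable F := Summable.of_norm_bounded hBs hFB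
  have hFk : ∀ k, HasSum (fun mn => F (k, mn)) ((k.factorial : ℂ)⁻¹ • (z • (S + T)) ^ k) := by
    intro k
    have := hasSum_antidiag k (fun mn => F (k, mn)) (fun mn hmn => by
      simp [hF, bal_zero_of_lt _ _ hmn])
    convert this using 1
    rw [smul_pow, ← pow_normal S T h, Finset.smul_sum, Finset.smul_sum]
    refine Finset.sum_congr rfl fun N _ => ?_
    rw [normW, Finset.mul_sum, Finset.smul_sum, Finset.smul_sum]
    refine Finset.sum_congr rfl fun mn hmn => ?_
    rw [Finset.HasAntidiagonal.mem_antidiagonal] at hmn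
    simp only [hF, hmn]
    rw [← nsmul_eq_mul, ← Nat.cast_smul_eq_nsmul ℂ, smul_smul, smul_smul]
    congr 1
    ring
  have hFsum : HasSum F (NormedSpace.exp (z • (S + T))) := by
    have h1 := hFs.hasSum.prod_fiberwise hFk
    have h2 := NormedSpace.exp_series_hasSum_exp' (𝕂 := ℂ) (z • (S + T))
    rw [h2.unique h1]
    exact hFs.hasSum
  have hBs' : Summable (fun q : (ℕ × ℕ) × ℕ => B (q.2, q.1)) :=
    (Equiv.prodComm _ _).summable_iff.mpr hBs
  have hF' : HasSum (fun q : (ℕ × ℕ) × ℕ => F (q.2, q.1)) (NormedSpace.exp (z • (S + T))) :=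
    (Equiv.prodComm _ _).hasSum_iff.mpr hFsum
  have hmn : ∀ mn : ℕ × ℕ, HasSum (fun k => F (k, mn))
      ((Complex.I ^ (mn.1 + mn.2) *
          (besselJ (mn.1 + mn.2 + 2) (2 * t) + besselJ (mn.1 + mn.2) (2 * t))) •
            (S ^ mn.1 * T ^ mn.2)) := fun mn =>
    (bessel_coeff (mn.1 + mn.2) t).smul_const (S ^ mn.1 * T ^ mn.2)
  refine ⟨hF'.prod_fiberwise hmn, ?_⟩
  have h3 := (summable_prod_of_nonneg (fun q => hB0 _)).mp hBs'
  refine Summable.of_nonneg_of_le (fun _ => norm_nonneg _) (fun mn => ?_) h3.2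
  rw [← (hmn mn).tsum_eq]
  exact tsum_of_norm_bounded (h3.1 mn).hasSum (fun k => hFB _)

/-- `exp(itX) = Σ_{m,n≥0} i^{m+n} (J_{m+n+2}(2t) + J_{m+n}(2t)) Sᵐ Tⁿ`,
the double series being absolutely convergent in operator norm. -/
theorem statement_12
    {H : Type*} [NormedAddCommGroup H] [InnerProductSpace ℂ H] [CompleteSpace H]
    (e : HilbertBasis ℕ ℂ H)
    (S : H →L[ℂ] H) (hS : ∀ n : ℕ, S (e n) = e (n + 1))
    (T : H →L[ℂ] H) (hT : T = ContinuousLinearMap.adjoint S)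
    (X : H →L[ℂ] H) (hX : X = S + T) (t : ℂ) :
    HasSum
        (fun mn : ℕ × ℕ =>
          (Complex.I ^ (mn.1 + mn.2) *
              (besselJ (mn.1 + mn.2 + 2) (2 * t) + besselJ (mn.1 + mn.2) (2 * t))) •
            (S ^ mn.1 * T ^ mn.2))
        (NormedSpace.exp ((Complex.I * t) • X)) ∧
      Summable
        (fun mn : ℕ × ℕ =>
          ‖(Complex.I ^ (mn.1 + mn.2) *
              (besselJ (mn.1 + mn.2 + 2) (2 * t) + besselJ (mn.1 + mn.2) (2 * t))) •
            (S ^ mn.1 * T ^ mn.2)‖) := by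
  have hTS : T * S = 1 := by
    have hd : Dense (Submodule.span ℂ (Set.range e) : Set H) := by
      rw [Submodule.dense_iff_topologicalClosure_eq_top]; exact e.dense_span
    refine ContinuousLinearMap.ext_on hd ?_
    rintro _ ⟨n, rfl⟩
    apply e.repr.injective
    ext m
    rw [e.repr_apply_apply, e.repr_apply_apply, hT, mul_apply_eq_comp,
      ContinuousLinearMap.adjoint_inner_right, hS, hS, one_apply_eq_self,
      orthonormal_iff_ite.mp e.orthonormal, orthonormal_iff_ite.mp e.orthonormal]
    simp
  have hS1 : ‖S‖ ≤ 1 := by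
    have h1 : ‖S‖ * ‖S‖ = ‖(1 : H →L[ℂ] H)‖ := by
      rw [← hTS, hT, ← ContinuousLinearMap.norm_adjoint_comp_self]; rfl
    have h2 : ‖(1 : H →L[ℂ] H)‖ ≤ 1 := ContinuousLinearMap.norm_id_le
    nlinarith [norm_nonneg S]
  have hT1 : ‖T‖ ≤ 1 := by rw [hT, LinearIsometryEquiv.norm_map]; exact hS1
  have hp : ∀ (Y : H →L[ℂ] H), ‖Y‖ ≤ 1 → ∀ n : ℕ, ‖Y ^ n‖ ≤ 1 := by
    intro Y hY n
    induction n with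
    | zero => rw [pow_zero]; exact ContinuousLinearMap.norm_id_le
    | succ n ih =>
      rw [pow_succ]
      exact (norm_mul_le _ _).trans (mul_le_one₀ ih (norm_nonneg _) hY)
  rw [hX]
  exact exp_normal S T hTS (fun m n => (norm_mul_le _ _).trans
    (mul_le_one₀ (hp S hS1 m) (norm_nonneg _) (hp T hT1 n))) t
end

section
/- For every real t and all m, n ∈ ℕ, the Heisenberg-evolved creation operator a⁺_t := exp(itP)·S·exp(−itP) satisfies ⟨e_m, a⁺_t e_n⟩ = ⟨e_m, S e_n⟩ + (−1)^{m+n}(m+1)(n+1)·∫₀^t J_{m+1}(2s)·J_{n+1}(2s)/s² ds, where the integrand (which extends continuously to s = 0) is integrable on [0,t]. -/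
open scoped InnerProductSpace

/-- Bessel function of the first kind of integer order `n` (real variable):
`J_n(x) = Σ_{p≥0} (-1)^p/(p!(n+p)!) (x/2)^{n+2p}`. -/
noncomputable def besselJR (n : ℕ) (x : ℝ) : ℝ :=
  ∑' p : ℕ, ((-1) ^ p / ((Nat.factorial p : ℝ) * (Nat.factorial (n + p) : ℝ))) *
    (x / 2) ^ (n + 2 * p)

noncomputable def ballotAux : ℕ → ℕ → ℝ
  | 0, m => if m = 0 then 1 else 0
  | k + 1, 0 => ballotAux k 1
  | k + 1, m + 1 => ballotAux k (m + 2) - ballotAux k m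

theorem ballotAux_spec (k : ℕ) : ∀ m : ℕ,
    (∀ p : ℕ, k = m + 2 * p → ballotAux k m =
      (-1) ^ (m + p) * ((m : ℝ) + 1) * (Nat.factorial k : ℝ) /
        ((Nat.factorial p : ℝ) * (Nat.factorial (m + 1 + p) : ℝ))) ∧
    ((∀ p : ℕ, k ≠ m + 2 * p) → ballotAux k m = 0) := by
  induction k with
  | zero =>
    intro m
    constructor
    · intro p hp
      obtain rfl : m = 0 := by omega
      obtain rfl : p = 0 := by omega
      simp [ballotAux]
    · intro h
      have : m ≠ 0 := fun h0 => h 0 (by omega)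
      simp [ballotAux, this]
  | succ k ih =>
    intro m
    rcases m with _ | m
    · constructor
      · intro p hp
        obtain ⟨q, rfl⟩ : ∃ q, p = q + 1 := ⟨p - 1, by omega⟩
        obtain rfl : k = 1 + 2 * q := by omega
        rw [ballotAux, (ih 1).1 q rfl]
        have e1 : 1 + 1 + q = (q + 1) + 1 := by ring
        have e2 : 0 + 1 + (q + 1) = (q + 1) + 1 := by ring
        rw [e1, e2, Nat.factorial_succ (1 + 2 * q), Nat.factorial_succ (q + 1),
          Nat.factorial_succ q]
        have h1 : (Nat.factorial q : ℝ) ≠ 0 := by exact_mod_cast Nat.factorial_ne_zero q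
        have h2 : (q : ℝ) + 1 ≠ 0 := by positivity
        have h3 : (q : ℝ) + 1 + 1 ≠ 0 := by positivity
        push_cast
        field_simp
        ring
      · intro h
        rw [ballotAux, (ih 1).2]
        intro p hp
        exact h (p + 1) (by omega)
    · constructor
      · intro p hp
        obtain rfl : k = m + 2 * p := by omega
        rw [ballotAux, (ih m).1 p rfl]
        rcases p with _ | q
        · rw [(ih (m + 2)).2 (by intro p; omega)]
          have h1 : (Nat.factorial m : ℝ) ≠ 0 := by exact_mod_cast Nat.factorial_ne_zero m
          have h3 : (m : ℝ) + 1 + 1 ≠ 0 := by positivity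
          have h2 : (m : ℝ) + 1 ≠ 0 := by positivity
          simp only [mul_zero, add_zero, Nat.factorial_succ, Nat.factorial_zero]
          push_cast
          field_simp
          ring
        · rw [(ih (m + 2)).1 q (by ring)]
          have e1 : m + 2 + 1 + q = (m + 1 + q) + 1 + 1 := by ring
          have e2 : m + 1 + (q + 1) = (m + 1 + q) + 1 := by ring
          have e3 : m + 1 + 1 + (q + 1) = (m + 1 + q) + 1 + 1 := by ring
          rw [e1, e2, e3, Nat.factorial_succ (m + 2 * (q + 1)),
            Nat.factorial_succ (m + 1 + q + 1), Nat.factorial_succ (m + 1 + q),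
            Nat.factorial_succ q]
          have h1 : (Nat.factorial q : ℝ) ≠ 0 := by exact_mod_cast Nat.factorial_ne_zero q
          have h1' : (Nat.factorial (m + 1 + q) : ℝ) ≠ 0 := by
            exact_mod_cast Nat.factorial_ne_zero _
          have h2 : (q : ℝ) + 1 ≠ 0 := by positivity
          have h3 : (m : ℝ) + 1 + q + 1 ≠ 0 := by positivity
          have h4 : (m : ℝ) + 1 + q + 1 + 1 ≠ 0 := by positivity
          push_cast
          field_simp
          ring
      · intro h
        rw [ballotAux, (ih m).2, (ih (m + 2)).2, sub_zero]
        · intro p hp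
          exact h (p + 1) (by omega)
        · intro p hp
          exact h p (by omega)

section aux
variable {H : Type*} [NormedAddCommGroup H] [InnerProductSpace ℂ H] [CompleteSpace H]

theorem adj_e (e : HilbertBasis ℕ ℂ H)
    (S : H →L[ℂ] H) (hS : ∀ k : ℕ, S (e k) = e (k + 1)) :
    ContinuousLinearMap.adjoint S (e 0) = 0 ∧
    ∀ k, ContinuousLinearMap.adjoint S (e (k + 1)) = e k := by
  have key : ∀ i k, ⟪e i, ContinuousLinearMap.adjoint S (e k)⟫_ℂ = if i + 1 = k then 1 else 0 := by
    intro i k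
    rw [ContinuousLinearMap.adjoint_inner_right, hS, orthonormal_iff_ite.mp e.orthonormal]
  constructor
  · apply e.repr.injective
    ext i
    rw [HilbertBasis.repr_apply_apply, HilbertBasis.repr_apply_apply, key]
    simp
  · intro k
    apply e.repr.injective
    ext i
    rw [HilbertBasis.repr_apply_apply, HilbertBasis.repr_apply_apply, key,
      orthonormal_iff_ite.mp e.orthonormal]
    simp

theorem comm_rel (e : HilbertBasis ℕ ℂ H)
    (S : H →L[ℂ] H) (hS : ∀ k : ℕ, S (e k) = e (k + 1)) (x : H) :
    ContinuousLinearMap.adjoint S (S x) - S (ContinuousLinearMap.adjoint S x)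
      = ⟪e 0, x⟫_ℂ • e 0 := by
  obtain ⟨h0, h1⟩ := adj_e e S hS
  have : (ContinuousLinearMap.adjoint S ∘L S - S ∘L ContinuousLinearMap.adjoint S)
      = (innerSL ℂ (e 0)).smulRight (e 0) := by
    apply ContinuousLinearMap.ext_on
      (s := Set.range e) (Submodule.dense_iff_topologicalClosure_eq_top.mpr e.dense_span)
    rintro _ ⟨k, rfl⟩
    have ho := orthonormal_iff_ite.mp e.orthonormal 0 k
    rcases k with _ | k
    · simp [hS, h0, h1, e.orthonormal.1 0]
    · simp [hS, h1, ho]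
  have h2 := congrArg (fun L => L x) this
  simpa using h2

theorem inner_pow (e : HilbertBasis ℕ ℂ H)
    (S : H →L[ℂ] H) (hS : ∀ k : ℕ, S (e k) = e (k + 1)) (k : ℕ) : ∀ m : ℕ,
    ⟪e m, ((ContinuousLinearMap.adjoint S - S) ^ k) (e 0)⟫_ℂ = (ballotAux k m : ℂ) := by
  obtain ⟨h0, h1⟩ := adj_e e S hS
  induction k with
  | zero =>
    intro m
    have ho := orthonormal_iff_ite.mp e.orthonormal m 0
    rw [pow_zero, one_apply_eq_self, ho]
    by_cases hm : m = 0 <;> simp [hm, ballotAux]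
  | succ k ih =>
    intro m
    rw [pow_succ']
    rw [mul_apply_eq_comp, sub_apply, inner_sub_right,
      ContinuousLinearMap.adjoint_inner_right, ← ContinuousLinearMap.adjoint_inner_left S, hS, ih]
    rcases m with _ | m
    · simp [h0, ballotAux]
    · rw [h1, ih]
      simp [ballotAux]

theorem inner_exp (e : HilbertBasis ℕ ℂ H)
    (S : H →L[ℂ] H) (hS : ∀ k : ℕ, S (e k) = e (k + 1)) (t : ℝ) (m : ℕ) :
    (t : ℂ) * ⟪e m, NormedSpace.exp (t • (ContinuousLinearMap.adjoint S - S)) (e 0)⟫_ℂ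
     = (((-1) ^ m * ((m : ℝ) + 1) * besselJR (m + 1) (2 * t) : ℝ) : ℂ) := by
  set A := ContinuousLinearMap.adjoint S - S with hA
  have hs := NormedSpace.exp_series_hasSum_exp' (𝕂 := ℝ) (t • A)
  let L : (H →L[ℂ] H) →L[ℂ] ℂ := (innerSL ℂ (e m)).comp (ContinuousLinearMap.apply ℂ H (e 0))
  have h2 : HasSum (fun k : ℕ => ((((Nat.factorial k : ℝ))⁻¹ * t ^ k * ballotAux k m : ℝ) : ℂ))
      ⟪e m, NormedSpace.exp (t • A) (e 0)⟫_ℂ := by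
    have := hs.mapL L
    have heq : ∀ k : ℕ, ((((Nat.factorial k : ℝ))⁻¹ * t ^ k * ballotAux k m : ℝ) : ℂ)
        = L (((Nat.factorial k : ℝ))⁻¹ • (t • A) ^ k) := by
      intro k
      have hr : ∀ (r : ℝ) (B : H →L[ℂ] H), L (r • B) = (r : ℂ) * L B := by
        intro r B
        rw [← Complex.coe_smul r B, map_smul, smul_eq_mul]
      rw [smul_pow, smul_smul, hr, Complex.ofReal_mul, ← inner_pow e S hS k m]
      rfl
    simp only [heq]
    exact this
  have hinj : Function.Injective (fun p : ℕ => m + 2 * p) := by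
    intro a b h
    simp only at h
    omega
  have h3 := (hinj.hasSum_iff (by
    intro k hk
    have : ballotAux k m = 0 := by
      apply (ballotAux_spec k m).2
      intro p hp
      exact hk ⟨p, hp.symm⟩
    simp [this])).mpr h2
  have h4 := h3.mul_left (t : ℂ)
  rw [← h4.tsum_eq, besselJR, ← tsum_mul_left, Complex.ofReal_tsum]
  congr 1
  ext p
  simp only [Function.comp_apply]
  rw [(ballotAux_spec _ m).1 p rfl, ← Complex.ofReal_mul]
  congr 1
  have h1 : (Nat.factorial (m + 2 * p) : ℝ) ≠ 0 := by exact_mod_cast Nat.factorial_ne_zero _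
  have h5 : (Nat.factorial p : ℝ) ≠ 0 := by exact_mod_cast Nat.factorial_ne_zero _
  have h6 : (Nat.factorial (m + 1 + p) : ℝ) ≠ 0 := by exact_mod_cast Nat.factorial_ne_zero _
  have h7 : 2 * t / 2 = t := by ring
  rw [h7]
  field_simp
  ring

end aux

/-- for real `t` and all `m,n`, the Heisenberg-evolved creation operator
`a⁺_t = e^{itP} S e^{-itP}` has matrix entries
`⟨e_m, a⁺_t e_n⟩ = ⟨e_m, S e_n⟩ + (-1)^{m+n}(m+1)(n+1) ∫₀ᵗ J_{m+1}(2s) J_{n+1}(2s)/s² ds`,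
the integrand being interval-integrable on `[0,t]`. -/
theorem statement_15
    {H : Type*} [NormedAddCommGroup H] [InnerProductSpace ℂ H] [CompleteSpace H]
    (e : HilbertBasis ℕ ℂ H)
    (S : H →L[ℂ] H) (hS : ∀ k : ℕ, S (e k) = e (k + 1))
    (T : H →L[ℂ] H) (hT : T = ContinuousLinearMap.adjoint S)
    (P : H →L[ℂ] H) (hP : P = Complex.I • (S - T)) (t : ℝ) (m n : ℕ) :
    IntervalIntegrable
        (fun s : ℝ => besselJR (m + 1) (2 * s) * besselJR (n + 1) (2 * s) / s ^ 2)
        MeasureTheory.volume 0 t ∧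
      ⟪e m, (NormedSpace.exp ((Complex.I * t) • P) * S *
          NormedSpace.exp ((-(Complex.I * t)) • P)) (e n)⟫_ℂ =
        ⟪e m, S (e n)⟫_ℂ +
          (-1) ^ (m + n) * ((m : ℂ) + 1) * ((n : ℂ) + 1) *
            ((∫ s in (0 : ℝ)..t,
              besselJR (m + 1) (2 * s) * besselJR (n + 1) (2 * s) / s ^ 2 : ℝ) : ℂ) := by
  obtain ⟨h0, h1⟩ := adj_e e S hS
  subst hT
  set A := ContinuousLinearMap.adjoint S - S with hA
  have hU : ∀ s : ℝ, (Complex.I * s) • P = s • A := by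
    intro s
    rw [hP, smul_smul, hA]
    rw [show Complex.I * s * Complex.I = -(s : ℂ) by
      rw [mul_comm, ← mul_assoc, Complex.I_mul_I]; ring]
    rw [neg_smul, ← smul_neg, neg_sub]
    exact Complex.coe_smul s _
  have hU' : ∀ s : ℝ, (-(Complex.I * s)) • P = s • (-A) := by
    intro s
    rw [neg_smul, hU, smul_neg]
  rw [hU, hU']
  have hstar : star A = -A := by
    rw [hA, star_sub, ContinuousLinearMap.star_eq_adjoint, ContinuousLinearMap.star_eq_adjoint,
      ContinuousLinearMap.adjoint_adjoint, neg_sub]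
  let c : ℕ → ℝ → ℂ := fun m s => ⟪e m, NormedSpace.exp (s • A) (e 0)⟫_ℂ
  have hexp : ∀ (B : H →L[ℂ] H) (s : ℝ), HasDerivAt (fun u : ℝ => NormedSpace.exp (u • B))
      (NormedSpace.exp (s • B) * B) s := fun B s => hasDerivAt_exp_smul_const B s
  have hexp' : ∀ (B : H →L[ℂ] H) (s : ℝ), HasDerivAt (fun u : ℝ => NormedSpace.exp (u • B))
      (B * NormedSpace.exp (s • B)) s := fun B s => hasDerivAt_exp_smul_const' B s
  have hexpc : ∀ B : H →L[ℂ] H, Continuous (fun u : ℝ => NormedSpace.exp (u • B)) := fun B =>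
    continuous_iff_continuousAt.mpr fun s => (hexp B s).continuousAt
  have hc : ∀ m, Continuous (c m) := by
    intro m
    exact continuous_const.inner ((hexpc A).clm_apply continuous_const)
  have hcb : ∀ (m : ℕ) (s : ℝ), (s : ℂ) * c m s =
      (((-1) ^ m * ((m : ℝ) + 1) * besselJR (m + 1) (2 * s) : ℝ) : ℂ) :=
    fun m s => inner_exp e S hS s m
  have hc2 : ∀ (m : ℕ) (s : ℝ), s ≠ 0 → c m s =
      (((-1) ^ m * ((m : ℝ) + 1) * besselJR (m + 1) (2 * s) / s : ℝ) : ℂ) := by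
    intro m s hs
    have hs' : (s : ℂ) ≠ 0 := by exact_mod_cast hs
    rw [Complex.ofReal_div, ← hcb]
    field_simp
  have hc3 : ∀ (n : ℕ) (s : ℝ), s ≠ 0 →
      ⟪e 0, NormedSpace.exp (s • (-A)) (e n)⟫_ℂ = c n s := by
    intro n s hs
    have : NormedSpace.exp (s • (-A)) = ContinuousLinearMap.adjoint (NormedSpace.exp (s • A)) := by
      rw [← ContinuousLinearMap.star_eq_adjoint, NormedSpace.star_exp, star_smul, hstar]
      simp
    rw [this, ContinuousLinearMap.adjoint_inner_right, ← inner_conj_symm]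
    change (starRingEnd ℂ) (c n s) = c n s
    rw [hc2 n s hs, Complex.conj_ofReal]
  let g : ℝ → ℝ := fun s => besselJR (m + 1) (2 * s) * besselJR (n + 1) (2 * s) / s ^ 2
  let K : ℝ := (-1) ^ (m + n) * ((m : ℝ) + 1) * ((n : ℝ) + 1)
  have hK2 : K ≠ 0 := by
    have h1 : (m : ℝ) + 1 ≠ 0 := by positivity
    have h2 : (n : ℝ) + 1 ≠ 0 := by positivity
    simp [K, h1, h2]
  have hg : ∀ s : ℝ, s ≠ 0 → c m s * c n s = ((K * g s : ℝ) : ℂ) := by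
    intro s hs
    rw [hc2 m s hs, hc2 n s hs, ← Complex.ofReal_mul]
    congr 1
    simp only [K, g]
    field_simp
    ring
  have hne : ∀ᵐ s : ℝ ∂MeasureTheory.volume, s ≠ 0 :=
    MeasureTheory.Measure.ae_ne MeasureTheory.volume 0
  have hint : IntervalIntegrable g MeasureTheory.volume 0 t := by
    have hcont : Continuous (fun s => K⁻¹ * (c m s * c n s).re) :=
      continuous_const.mul (Complex.continuous_re.comp ((hc m).mul (hc n)))
    refine (hcont.intervalIntegrable 0 t).congr_ae ?_
    apply MeasureTheory.ae_restrict_of_ae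
    filter_upwards [hne] with s hs
    rw [hg s hs, Complex.ofReal_re]
    field_simp
  refine ⟨hint, ?_⟩
  let F : ℝ → ℂ := fun u => ⟪e m, (NormedSpace.exp (u • A) * S * NormedSpace.exp (u • (-A))) (e n)⟫_ℂ
  let D : ℝ → ℂ := fun u => c m u * ⟪e 0, NormedSpace.exp (u • (-A)) (e n)⟫_ℂ
  have hF : ∀ u, HasDerivAt F (D u) u := by
    intro u
    have h2 := ((hexp A u).mul_const S).mul (hexp' (-A) u)
    let L : (H →L[ℂ] H) →L[ℂ] ℂ := (innerSL ℂ (e m)).comp (ContinuousLinearMap.apply ℂ H (e n))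
    have h4 : HasDerivAt F _ u := (L.restrictScalars ℝ).hasFDerivAt.comp_hasDerivAt u h2
    refine h4.congr_deriv ?_
    simp only [D, c]
    have hcr : ∀ x, A (S x) - S (A x) = ⟪e 0, x⟫_ℂ • e 0 := by
      intro x
      rw [← comm_rel e S hS x, hA]
      simp
    set V := NormedSpace.exp (u • A)
    set x := NormedSpace.exp (u • (-A)) (e n) with hx
    have : (V * A * S * NormedSpace.exp (u • (-A)) +
        V * S * (-A * NormedSpace.exp (u • (-A)))) (e n) = ⟪e 0, x⟫_ℂ • V (e 0) := by
      rw [← map_smul, ← hcr x, hx]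
      simp [sub_eq_add_neg]
    simp only [ContinuousLinearMap.coe_restrictScalars']
    change ⟪e m, (V * A * S * NormedSpace.exp (u • (-A)) +
        V * S * (-A * NormedSpace.exp (u • (-A)))) (e n)⟫_ℂ = _
    rw [this, inner_smul_right, mul_comm]
  have hDc : Continuous D :=
    (hc m).mul (continuous_const.inner ((hexpc (-A)).clm_apply continuous_const))
  have hftc := intervalIntegral.integral_eq_sub_of_hasDerivAt (a := 0) (b := t)
    (fun u _ => hF u) (hDc.intervalIntegrable 0 t)
  have hD : (∫ s in (0 : ℝ)..t, D s) = ((K * ∫ s in (0 : ℝ)..t, g s : ℝ) : ℂ) := by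
    rw [← intervalIntegral.integral_const_mul, ← intervalIntegral.integral_ofReal]
    apply intervalIntegral.integral_congr_ae
    filter_upwards [hne] with s hs _
    simp only [D]
    rw [hc3 n s hs, hg s hs]
  have hF0 : F 0 = ⟪e m, S (e n)⟫_ℂ := by
    simp [F]
  rw [hD, hF0] at hftc
  change F t = _ + _ * ((∫ s in (0 : ℝ)..t, g s : ℝ) : ℂ)
  rw [sub_eq_iff_eq_add.mp hftc.symm]
  simp only [K]
  push_cast
  ring
end
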